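/- arXiv:2109.04558 — 2 statements merged into one kernel-verified Lean document; each statement's English description precedes it below -/
import Mathlib

section
/- Let 1 ≤ k ≤ n and let P be an n×n complex matrix with P² = P = P* and rank(P) = k. Then: (a) there exists g ∈ U_n^{>0} such that P = g·diag(1,…,1,0,…,0)·g* (with k ones followed by n−k zeros on the diagonal) if and only if every k×k minor Δ_{I,J}(P) is a positive real number; (b) P lies in the closure (in the space of n×n complex matrices) of the set of matrices described in (a) if and only if every k×k minor of P is a nonnegative real number. -/
open Matrix Finset

/-- The minor of a square matrix `g` on row set `I` and column set `J`
(rows and columns listed in increasing order); defined to be `0` if `I` and `J`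
have different cardinalities. -/
noncomputable def minorOn {R : Type} [CommRing R] {n : ℕ} (g : Matrix (Fin n) (Fin n) R)
    (I J : Finset (Fin n)) : R :=
  if h : J.card = I.card then
    Matrix.det (Matrix.of fun a b : Fin I.card =>
      g ((I.orderIsoOfFin rfl a : Fin n)) ((J.orderIsoOfFin h b : Fin n)))
  else 0

/-- The left-justified minor `Δ_I(g)`: the minor on rows `I` and the first `|I|` columns. -/
noncomputable def leftMinor {R : Type} [CommRing R] {n : ℕ} (g : Matrix (Fin n) (Fin n) R)
    (I : Finset (Fin n)) : R :=
  minorOn g I (Finset.univ.filter fun j : Fin n => (j : ℕ) < I.card)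

/-- A complex number is a positive real. -/
def IsPosReal (z : ℂ) : Prop := 0 < z.re ∧ z.im = 0

/-- A complex number is a nonnegative real. -/
def IsNonnegReal (z : ℂ) : Prop := 0 ≤ z.re ∧ z.im = 0

/-- The diagonal sign matrix `δ_n = diag(1, −1, 1, …, (−1)^{n−1})`. -/
noncomputable def deltaMat (n : ℕ) : Matrix (Fin n) (Fin n) ℂ :=
  Matrix.diagonal fun i : Fin n => (-1 : ℂ) ^ (i : ℕ)

/-- The totally positive part `U_n^{>0}` of the unitary group: unitary matrices all of
whose left-justified minors are positive real numbers. -/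
def UnitaryTP (n : ℕ) : Set (Matrix (Fin n) (Fin n) ℂ) :=
  {g | g.conjTranspose * g = 1 ∧ ∀ I : Finset (Fin n), IsPosReal (leftMinor g I)}

section TPProj
open scoped ComplexOrder

/-- All maximal minors positive. -/
def MP {n m : ℕ} (V : Matrix (Fin n) (Fin m) ℂ) : Prop :=
  ∀ f : Fin m → Fin n, StrictMono f → 0 < (V.submatrix f id).det

/-- All left justified minors positive. -/
def FP {n m : ℕ} (V : Matrix (Fin n) (Fin m) ℂ) : Prop :=
  ∀ j (h : j ≤ m), MP (V.submatrix id (Fin.castLE h))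

/-- Append a column. -/
def snocCol {n m : ℕ} (V : Matrix (Fin n) (Fin m) ℂ) (w : Fin n → ℂ) :
    Matrix (Fin n) (Fin (m + 1)) ℂ :=
  Matrix.of fun i => (Fin.snoc (V i) (w i) : Fin (m + 1) → ℂ)

@[simp] lemma snocCol_castSucc {n m : ℕ} (V : Matrix (Fin n) (Fin m) ℂ) (w : Fin n → ℂ) (i : Fin n)
    (j : Fin m) : snocCol V w i j.castSucc = V i j := by simp [snocCol]

@[simp] lemma snocCol_last {n m : ℕ} (V : Matrix (Fin n) (Fin m) ℂ) (w : Fin n → ℂ) (i : Fin n) :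
    snocCol V w i (Fin.last m) = w i := by simp [snocCol]

lemma eq_snocCol {n m : ℕ} (V : Matrix (Fin n) (Fin (m + 1)) ℂ) :
    V = snocCol (V.submatrix id Fin.castSucc) (fun i => V i (Fin.last m)) := by
  ext i j
  induction j using Fin.lastCases <;> simp

lemma MP.mul {n m : ℕ} {V : Matrix (Fin n) (Fin m) ℂ} (hV : MP V) {C : Matrix (Fin m) (Fin m) ℂ}
    (hC : 0 < C.det) : MP (V * C) := by
  intro f hf
  have : (V * C).submatrix f id = V.submatrix f id * C := by
    ext i j; simp [Matrix.mul_apply]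
  rw [this, Matrix.det_mul]
  exact mul_pos (hV f hf) hC

lemma FP.snoc {n m : ℕ} {V : Matrix (Fin n) (Fin m) ℂ} {w : Fin n → ℂ} (hV : FP V)
    (h : MP (snocCol V w)) : FP (snocCol V w) := by
  intro j hj
  rcases Nat.lt_or_ge m j with h1 | h1
  · obtain rfl : j = m + 1 := by omega
    exact h
  · have := hV j h1
    convert this using 1
    ext i a
    simp only [Matrix.submatrix_apply, id]
    rw [← snocCol_castSucc V w]
    rfl

/-- Block upper triangular extension. -/
def blk {m : ℕ} (R : Matrix (Fin m) (Fin m) ℂ) (y : Fin m → ℂ) (c : ℂ) :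
    Matrix (Fin (m + 1)) (Fin (m + 1)) ℂ :=
  Matrix.of fun a => (Fin.snoc (fun a => (Fin.snoc (R a) (y a) : Fin (m + 1) → ℂ))
    (Fin.snoc (fun _ => 0) c : Fin (m + 1) → ℂ) : Fin (m + 1) → Fin (m + 1) → ℂ) a

lemma snocCol_mul_blk {n m : ℕ} (V : Matrix (Fin n) (Fin m) ℂ) (w : Fin n → ℂ)
    (R : Matrix (Fin m) (Fin m) ℂ) (y : Fin m → ℂ) (c : ℂ) :
    snocCol V w * blk R y c = snocCol (V * R) (V *ᵥ y + c • w) := by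
  ext i b
  induction b using Fin.lastCases with
  | last => simp [Matrix.mul_apply, Fin.sum_univ_castSucc, blk, Matrix.mulVec, dotProduct, mul_comm]
  | cast b => simp [Matrix.mul_apply, Fin.sum_univ_castSucc, blk]

lemma det_blk {m : ℕ} (R : Matrix (Fin m) (Fin m) ℂ) (y : Fin m → ℂ) (c : ℂ) :
    (blk R y c).det = R.det * c := by
  rw [Matrix.det_succ_row _ (Fin.last m), Fin.sum_univ_castSucc]
  have : (blk R y c).submatrix Fin.castSucc Fin.castSucc = R := by
    ext a b; simp [blk]
  simp only [Fin.succAbove_last, this]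
  simp [blk, ← two_mul, mul_comm]

lemma eventually_pos {ι : Type} [Fintype ι] [DecidableEq ι] (D : ι → ℂ) (e : ι → ℕ) (i0 : ι)
    (hr : ∀ i, (D i).im = 0) (h0 : 0 < D i0) (h : ∀ i, i ≠ i0 → D i = 0 ∨ e i < e i0) :
    ∀ᶠ t : ℝ in Filter.atTop, 0 < ∑ i, D i * (t : ℂ) ^ (e i) := by
  have key : Filter.Tendsto (fun t : ℝ => ∑ i, (D i).re * (t ^ (e i) / t ^ (e i0))) Filter.atTop
      (nhds (∑ i, if i = i0 then (D i0).re else 0)) := by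
    apply tendsto_finsetSum
    intro i _
    split_ifs with hi
    · subst hi
      apply tendsto_const_nhds.congr'
      filter_upwards [Filter.eventually_gt_atTop 0] with t ht
      rw [div_self (by positivity), mul_one]
    · rcases h i hi with h | h
      · simp [h]
      · have := (tendsto_pow_div_pow_atTop_zero (𝕜 := ℝ) h).const_mul (D i).re
        simpa using this
  have hp : 0 < (D i0).re := (Complex.pos_iff.1 h0).1
  simp only [Finset.sum_ite_eq', Finset.mem_univ, if_true] at key
  filter_upwards [key.eventually_const_lt hp, Filter.eventually_gt_atTop 0] with t ht ht0
  have e1 : ∑ i, D i * (t : ℂ) ^ (e i) = ((∑ i, (D i).re * t ^ (e i) : ℝ) : ℂ) := by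
    push_cast
    refine Finset.sum_congr rfl fun i _ => ?_
    congr 1
    apply Complex.ext <;> simp [hr]
  rw [e1, Complex.zero_lt_real]
  have : ∑ i, (D i).re * t ^ (e i) = (∑ i, (D i).re * (t ^ (e i) / t ^ (e i0))) * t ^ (e i0) := by
    rw [Finset.sum_mul]
    refine Finset.sum_congr rfl fun i _ => ?_
    have : t ^ (e i0) ≠ 0 := by positivity
    field_simp
  rw [this]; exact mul_pos ht (by positivity)

lemma eventually_MP_snoc {n m : ℕ} {V : Matrix (Fin n) (Fin m) ℂ} (hV : MP V) :
    ∃ w, MP (snocCol V w) := by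
  have : ∀ᶠ t : ℝ in Filter.atTop, ∀ f : Fin (m + 1) → Fin n, StrictMono f →
      0 < ((snocCol V fun i => (t : ℂ) ^ (i : ℕ)).submatrix f id).det := by
    rw [Filter.eventually_all]
    intro f
    by_cases hf : StrictMono f
    swap
    · simp [hf]
    have hpos : ∀ i : Fin (m + 1), 0 < (V.submatrix (f ∘ i.succAbove) id).det := fun i =>
      hV _ (hf.comp (Fin.strictMono_succAbove i))
    have := eventually_pos (fun i : Fin (m + 1) => (-1) ^ ((i : ℕ) + m) *
      (V.submatrix (f ∘ i.succAbove) id).det) (fun i => (f i : ℕ)) (Fin.last m) ?_ ?_ ?_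
    · filter_upwards [this] with t ht _
      rw [Matrix.det_succ_column _ (Fin.last m)]
      convert ht using 2 with i
      have : ((snocCol V fun i => (t : ℂ) ^ (i : ℕ)).submatrix f id).submatrix i.succAbove
          (Fin.last m).succAbove = V.submatrix (f ∘ i.succAbove) id := by
        ext a b; simp
      rw [this]; simp; ring
    · intro i
      have := (Complex.pos_iff.1 (hpos i)).2
      rcases neg_one_pow_eq_or ℂ ((i : ℕ) + m) with h | h <;> simp [h, ← this]
    · have := hpos (Fin.last m)
      simpa [← two_mul] using this
    · intro i hi
      right
      exact hf (Fin.lt_last_iff_ne_last.2 hi)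
  obtain ⟨t, ht⟩ := this.exists
  exact ⟨_, ht⟩

lemma orth_step {n m : ℕ} {V : Matrix (Fin n) (Fin m) ℂ} {w : Fin n → ℂ} (hmn : m + 1 ≤ n)
    (hV : Vᴴ * V = 1) (h : MP (snocCol V w)) : ∃ g, ∃ R : Matrix (Fin (m + 1)) (Fin (m + 1)) ℂ, snocCol V g = snocCol V w * R ∧
      (snocCol V g)ᴴ * snocCol V g = 1 ∧ MP (snocCol V g) := by
  set w' : Fin n → ℂ := w - V *ᵥ (Vᴴ *ᵥ w) with hw'
  have hort : Vᴴ *ᵥ w' = 0 := by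
    rw [hw', Matrix.mulVec_sub, Matrix.mulVec_mulVec, hV, Matrix.one_mulVec, sub_self]
  have hmul : ∀ c : ℂ, snocCol V w * blk 1 (-(c • (Vᴴ *ᵥ w))) c = snocCol V (c • w') := by
    intro c
    rw [snocCol_mul_blk, hw', Matrix.mul_one, smul_sub, Matrix.mulVec_neg, Matrix.mulVec_smul]
    congr 1; abel
  have hMP : ∀ c : ℂ, 0 < c → MP (snocCol V (c • w')) := by
    intro c hc
    rw [← hmul]
    exact h.mul (by simpa [det_blk] using hc)
  have hne : w' ≠ 0 := by
    intro h0
    have := hMP 1 zero_lt_one (Fin.castLE hmn) (Fin.strictMono_castLE hmn)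
    rw [Matrix.det_eq_zero_of_column_eq_zero (Fin.last m)] at this
    · exact lt_irrefl _ this
    · intro i; simp [h0]
  have hs : 0 < star w' ⬝ᵥ w' := dotProduct_star_self_pos_iff.2 hne
  obtain ⟨r, hr0, hr⟩ : ∃ r : ℝ, 0 < r ∧ (r : ℂ) = star w' ⬝ᵥ w' :=
    ⟨_, (Complex.pos_iff.1 hs).1, Complex.ext (by simp) (by simp [(Complex.pos_iff.1 hs).2])⟩
  set c : ℝ := (Real.sqrt r)⁻¹ with hc
  have hc0 : 0 < c := by positivity
  have hcr : c * c * r = 1 := by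
    rw [hc]
    have : Real.sqrt r ≠ 0 := by positivity
    field_simp
    rw [Real.sq_sqrt hr0.le]
  have hcrC : (c : ℂ) * c * r = 1 := by exact_mod_cast hcr
  refine ⟨(c : ℂ) • w', _, (hmul c).symm, ?_, hMP c (by exact_mod_cast hc0)⟩
  have hort' : ∀ a, ∑ x, star (V x a) * w' x = 0 := by
    intro a
    have := congrFun hort a
    simpa [Matrix.mulVec, dotProduct] using this
  have hort2 : ∀ a, ∑ x, star (w' x) * V x a = 0 := by
    intro a
    have := congrArg star (hort' a)
    rw [star_sum] at this
    simpa [mul_comm] using this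
  ext a b
  induction a using Fin.lastCases with
  | last =>
    induction b using Fin.lastCases with
    | last =>
      simp only [Matrix.mul_apply, Matrix.conjTranspose_apply, snocCol_last, Matrix.one_apply_eq]
      rw [hr] at hcrC
      rw [← hcrC, dotProduct, Finset.mul_sum]
      refine Finset.sum_congr rfl fun i _ => ?_
      simp; ring
    | cast b =>
      rw [Matrix.one_apply_ne (Fin.castSucc_lt_last b).ne']
      simp only [Matrix.mul_apply, Matrix.conjTranspose_apply, snocCol_last, snocCol_castSucc]
      rw [← mul_zero (c : ℂ), ← hort2 b, Finset.mul_sum]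
      refine Finset.sum_congr rfl fun i _ => ?_
      simp; ring
  | cast a =>
    induction b using Fin.lastCases with
    | last =>
      rw [Matrix.one_apply_ne (Fin.castSucc_lt_last a).ne]
      simp only [Matrix.mul_apply, Matrix.conjTranspose_apply, snocCol_last, snocCol_castSucc]
      rw [← mul_zero (c : ℂ), ← hort' a, Finset.mul_sum]
      refine Finset.sum_congr rfl fun i _ => ?_
      simp; ring
    | cast b =>
      have := congrFun (congrFun hV a) b
      simpa [Matrix.mul_apply, Matrix.one_apply] using this

lemma det_im_zero {n m : ℕ} {V : Matrix (Fin n) (Fin m) ℂ}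
    (hV : ∀ f : Fin m → Fin n, StrictMono f → ((V.submatrix f id).det).im = 0)
    (g : Fin m → Fin n) : ((V.submatrix g id).det).im = 0 := by
  by_cases hg : Function.Injective g
  · have h1 : StrictMono (g ∘ Tuple.sort g) :=
      (Tuple.monotone_sort g).strictMono_of_injective (hg.comp (Tuple.sort g).injective)
    have h2 := hV _ h1
    have h3 := Matrix.det_permute (Tuple.sort g) (V.submatrix g id)
    have h4 : (V.submatrix g id).submatrix (Tuple.sort g) id = V.submatrix (g ∘ Tuple.sort g) id := rfl
    rw [h4] at h3
    rw [h3] at h2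
    rcases Int.units_eq_one_or (Equiv.Perm.sign (Tuple.sort g)) with h | h <;> simpa [h] using h2
  · simp only [Function.Injective, not_forall] at hg
    obtain ⟨a, b, hab, hne⟩ := hg
    rw [Matrix.det_zero_of_row_eq hne]
    · simp
    · ext j; simp [hab]

lemma exists_insert {n m : ℕ} (hmn : m + 1 ≤ n) (f : Fin m → Fin n) (hf : StrictMono f) :
    ∃ p : Fin (m + 1), StrictMono (p.insertNth (Fin.castLE hmn p) f : Fin (m + 1) → Fin n) ∧
      ∀ j : Fin n, j ∉ Set.range f → Fin.castLE hmn p ≤ j := by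
  classical
  have hge : ∀ a : ℕ, ∀ h : a < m, a ≤ (f ⟨a, h⟩ : ℕ) := by
    intro a
    induction a with
    | zero => intro h; omega
    | succ a ih =>
      intro h
      have h1 := ih (by omega)
      have h2 : f ⟨a, by omega⟩ < f ⟨a + 1, h⟩ := hf (by simp [Fin.lt_def])
      rw [Fin.lt_def] at h2
      omega
  have hex : ∃ p : ℕ, ∀ h : p < m, p < (f ⟨p, h⟩ : ℕ) := ⟨m, fun h => by omega⟩
  have hsp := Nat.find_spec hex
  have hmin := fun q => @Nat.find_min _ _ hex q
  set p := Nat.find hex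
  have hpm : p ≤ m := Nat.find_min' hex (fun h => by omega)
  have hlt : ∀ a : ℕ, ∀ h : a < m, a < p → (f ⟨a, h⟩ : ℕ) = a := by
    intro a h hap
    have h1 := hmin a hap
    push Not at h1
    obtain ⟨h2, h3⟩ := h1
    have := hge a h
    omega
  refine ⟨⟨p, by omega⟩, ?_, ?_⟩
  · rw [Fin.strictMono_insertNth_iff]
    refine ⟨hf, ?_, ?_⟩
    · intro i hi
      rw [Fin.lt_def] at hi ⊢
      simp only [Fin.val_castSucc, Fin.val_castLE] at hi ⊢
      have := hlt i i.2 hi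
      simp only [Fin.eta] at this
      omega
    · intro i hi
      rw [Fin.lt_def]
      rw [Fin.le_def] at hi
      simp only [Fin.val_castSucc, Fin.val_castLE] at hi ⊢
      have h1 := hsp (by omega)
      have h2 : f ⟨p, by omega⟩ ≤ f i := hf.monotone (by simpa [Fin.le_def] using hi)
      rw [Fin.le_def] at h2
      omega
  · intro j hj
    by_contra hc
    rw [not_le, Fin.lt_def] at hc
    simp only [Fin.val_castLE] at hc
    apply hj
    refine ⟨⟨j, by omega⟩, ?_⟩
    apply Fin.ext
    exact hlt _ _ hc

/-- Append a row `u` to the rows of `V` chosen by `f`. -/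
def rowM {n m : ℕ} (V : Matrix (Fin n) (Fin (m + 1)) ℂ) (f : Fin m → Fin n)
    (u : Fin (m + 1) → ℂ) : Matrix (Fin (m + 1)) (Fin (m + 1)) ℂ :=
  Matrix.of (Fin.snoc (fun a => V (f a)) u : Fin (m + 1) → Fin (m + 1) → ℂ)

lemma det_rowM {n m : ℕ} (V : Matrix (Fin n) (Fin (m + 1)) ℂ) (f : Fin m → Fin n)
    (u : Fin (m + 1) → ℂ) : (rowM V f u).det =
      ∑ b : Fin (m + 1), (-1) ^ (m + (b : ℕ)) * u b * (V.submatrix f b.succAbove).det := by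
  rw [Matrix.det_succ_row _ (Fin.last m)]
  refine Finset.sum_congr rfl fun b _ => ?_
  have : (rowM V f u).submatrix (Fin.last m).succAbove b.succAbove = V.submatrix f b.succAbove := by
    ext i j; simp [rowM]
  rw [this]
  simp [rowM]

lemma det_rowM_sum {n m : ℕ} (V : Matrix (Fin n) (Fin (m + 1)) ℂ) (f : Fin m → Fin n)
    (c : Fin n → ℂ) : (rowM V f (∑ j, c j • V j)).det = ∑ j, c j * (rowM V f (V j)).det := by
  simp only [det_rowM, Finset.mul_sum]
  rw [Finset.sum_comm]
  refine Finset.sum_congr rfl fun b _ => ?_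
  rw [Finset.sum_apply, Finset.mul_sum, Finset.sum_mul]
  refine Finset.sum_congr rfl fun j _ => ?_
  simp; ring

lemma rowM_row {n m : ℕ} (V : Matrix (Fin n) (Fin (m + 1)) ℂ) (f : Fin m → Fin n) (j : Fin n) :
    rowM V f (V j) = V.submatrix (Fin.snoc f j : Fin (m + 1) → Fin n) id := by
  ext a b
  induction a using Fin.lastCases <;> simp [rowM]

lemma det_rowM_insert {n m : ℕ} (V : Matrix (Fin n) (Fin (m + 1)) ℂ) (f : Fin m → Fin n) (j : Fin n)
    (p : Fin (m + 1)) : (V.submatrix (p.insertNth j f : Fin (m + 1) → Fin n) id).det =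
      (-1) ^ (m + (p : ℕ)) * (rowM V f (V j)).det := by
  rw [Matrix.det_succ_row _ p, det_rowM, Finset.mul_sum]
  refine Finset.sum_congr rfl fun b _ => ?_
  have : (V.submatrix (p.insertNth j f : Fin (m + 1) → Fin n) id).submatrix p.succAbove b.succAbove
      = V.submatrix f b.succAbove := by
    ext i j; simp
  rw [this]
  have h2 : ((-1 : ℂ) ^ m) * (-1) ^ m = 1 := by rw [← mul_pow]; simp
  simp only [Matrix.submatrix_apply, Fin.insertNth_apply_same, id, pow_add]
  linear_combination (-(-1 : ℂ) ^ (p : ℕ) * (-1) ^ (b : ℕ) * V j b *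
    (V.submatrix f b.succAbove).det) * h2

lemma down_step {n m : ℕ} {V : Matrix (Fin n) (Fin (m + 1)) ℂ} (hV : MP V) (hmn : m + 1 ≤ n) :
    ∃ C : Matrix (Fin (m + 1)) (Fin (m + 1)) ℂ, 0 < C.det ∧
      MP ((V * C).submatrix id Fin.castSucc) := by
  have him : ∀ f : Fin (m + 1) → Fin n, StrictMono f → ((V.submatrix f id).det).im = 0 :=
    fun f hf => (Complex.pos_iff.1 (hV f hf)).2.symm
  have : ∀ᶠ t : ℝ in Filter.atTop, ∀ f : Fin m → Fin n, StrictMono f →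
      0 < (rowM V f (∑ j : Fin n, ((-1) ^ (m + (j : ℕ)) * (t : ℂ) ^ (n - 1 - (j : ℕ))) • V j)).det := by
    rw [Filter.eventually_all]
    intro f
    by_cases hf : StrictMono f
    swap
    · simp [hf]
    obtain ⟨p, hp1, hp2⟩ := exists_insert hmn f hf
    have := eventually_pos (fun j : Fin n => (-1) ^ (m + (j : ℕ)) * (rowM V f (V j)).det)
      (fun j => n - 1 - (j : ℕ)) (Fin.castLE hmn p) ?_ ?_ ?_
    · filter_upwards [this] with t ht _
      rw [det_rowM_sum]
      convert ht using 2 with i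
      ring
    · intro j
      have := det_im_zero him (Fin.snoc f j : Fin (m + 1) → Fin n)
      rw [← rowM_row] at this
      rcases neg_one_pow_eq_or ℂ (m + (j : ℕ)) with h | h <;> simp [h, this]
    · have := hV _ hp1
      rw [det_rowM_insert] at this
      simpa using this
    · intro j hj
      by_cases hjr : j ∈ Set.range f
      · left
        obtain ⟨a, rfl⟩ := hjr
        rw [Matrix.det_zero_of_row_eq (Fin.castSucc_lt_last a).ne, mul_zero]
        ext b; simp [rowM]
      · right
        have h1 := lt_of_le_of_ne (hp2 j hjr) (Ne.symm hj)
        rw [Fin.lt_def] at h1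
        have := j.2
        omega
  obtain ⟨t, ht⟩ := this.exists
  set u := ∑ j : Fin n, ((-1) ^ (m + (j : ℕ)) * (t : ℂ) ^ (n - 1 - (j : ℕ))) • V j
  have hM := ht (Fin.castLE (by omega)) (Fin.strictMono_castLE _)
  set M := rowM V (Fin.castLE (by omega)) u with hMdef
  have hMu : IsUnit M.det := isUnit_iff_ne_zero.2 hM.ne'
  have hdet : 0 < (M⁻¹).det := by
    have h1 : M.det * (M⁻¹).det = 1 := by
      rw [← Matrix.det_mul, Matrix.mul_nonsing_inv _ hMu, Matrix.det_one]
    exact pos_of_mul_pos_left (by rw [mul_comm, h1]; exact one_pos) hM.le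
  refine ⟨M⁻¹, hdet, ?_⟩
  have hu : ∀ b, (∑ a, u a * M⁻¹ a b) = if b = Fin.last m then 1 else 0 := by
    intro b
    have h1 := congrFun (congrFun (Matrix.mul_nonsing_inv _ hMu) (Fin.last m)) b
    rw [Matrix.mul_apply, Matrix.one_apply] at h1
    simp only [eq_comm (a := b)]
    rw [← h1]
    refine Finset.sum_congr rfl fun a _ => ?_
    simp [hMdef, rowM]
  intro f hf
  have h1 : 0 < (rowM V f u * M⁻¹).det := by
    rw [Matrix.det_mul]; exact mul_pos (ht f hf) hdet
  have h2 : rowM V f u * M⁻¹ = rowM (V * M⁻¹) f (fun b => if b = Fin.last m then 1 else 0) := by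
    ext a b
    induction a using Fin.lastCases with
    | last =>
      rw [Matrix.mul_apply]
      simp only [rowM, Matrix.of_apply, Fin.snoc_last]
      exact hu b
    | cast a => simp [rowM, Matrix.mul_apply]
  rw [h2, det_rowM, Fin.sum_univ_castSucc] at h1
  have h3 : ∀ i : Fin m, i.castSucc ≠ Fin.last m := fun i => (Fin.castSucc_lt_last i).ne
  simpa [h3, ← two_mul] using h1

lemma exists_orth_flag {n : ℕ} : ∀ m (_ : m ≤ n) (V : Matrix (Fin n) (Fin m) ℂ), MP V →
    ∃ G : Matrix (Fin n) (Fin m) ℂ, ∃ R : Matrix (Fin m) (Fin m) ℂ, G = V * R ∧ Gᴴ * G = 1 ∧ FP G := by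
  intro m
  induction m with
  | zero =>
    intro _ V hV
    refine ⟨V, 1, by simp, by ext i; exact i.elim0, ?_⟩
    intro j hj
    obtain rfl : j = 0 := by omega
    intro f hf
    simp
  | succ m ih =>
    intro hmn V hV
    obtain ⟨C, hC, hW⟩ := down_step hV hmn
    obtain ⟨G, R, hGR, hG1, hGF⟩ := ih (by omega) _ hW
    have hVC := eq_snocCol (V * C)
    set W := (V * C).submatrix id Fin.castSucc
    set w : Fin n → ℂ := fun i => (V * C) i (Fin.last m)
    have hR : 0 < R.det := by
      have h1 := hGF m le_rfl (Fin.castLE (by omega)) (Fin.strictMono_castLE _)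
      have h2 := hW (Fin.castLE (by omega)) (Fin.strictMono_castLE _)
      have h3 : (G.submatrix id (Fin.castLE le_rfl)).submatrix (Fin.castLE (by omega : m ≤ n)) id =
        W.submatrix (Fin.castLE (by omega)) id * R := by
        rw [hGR]; ext i j; simp [Matrix.mul_apply]
      rw [h3, Matrix.det_mul] at h1
      exact pos_of_mul_pos_right h1 h2.le
    have h4 := snocCol_mul_blk W w R 0 1
    rw [← hGR, ← hVC] at h4
    simp only [Matrix.mulVec_zero, one_smul, zero_add] at h4
    have h5 : MP (snocCol G w) := by
      rw [← h4]
      exact (hV.mul hC).mul (by simpa [det_blk] using hR)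
    obtain ⟨g, R', e1, e2, e3⟩ := orth_step hmn hG1 h5
    refine ⟨_, C * blk R 0 1 * R', ?_, e2, hGF.snoc e3⟩
    rw [e1, ← h4]
    simp only [Matrix.mul_assoc]

lemma exists_extend {n k : ℕ} (G : Matrix (Fin n) (Fin k) ℂ) (h1 : Gᴴ * G = 1) (hF : FP G) :
    ∀ m (hkm : k ≤ m), m ≤ n → ∃ H : Matrix (Fin n) (Fin m) ℂ, Hᴴ * H = 1 ∧ FP H ∧
      H.submatrix id (Fin.castLE hkm) = G := by
  intro m hkm
  induction m, hkm using Nat.le_induction with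
  | base => exact fun _ => ⟨G, h1, hF, rfl⟩
  | succ m hkm ih =>
    intro hmn
    obtain ⟨H, e1, e2, e3⟩ := ih (by omega)
    obtain ⟨w, hw⟩ := eventually_MP_snoc (e2 m le_rfl)
    obtain ⟨g, R, -, f2, f3⟩ := orth_step hmn e1 hw
    refine ⟨_, f2, e2.snoc f3, ?_⟩
    rw [← e3]
    ext i j
    simp only [Matrix.submatrix_apply, id]
    rw [← snocCol_castSucc H g]
    rfl

lemma minorOn_eq {n m : ℕ} (A : Matrix (Fin n) (Fin n) ℂ) (I J : Finset (Fin n)) (hI : I.card = m)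
    (hJ : J.card = m) :
    minorOn A I J = (A.submatrix (I.orderEmbOfFin hI) (J.orderEmbOfFin hJ)).det := by
  subst hI
  rw [minorOn, dif_pos hJ]
  rfl

lemma minorOn_image {n m : ℕ} (A : Matrix (Fin n) (Fin n) ℂ) (f g : Fin m → Fin n)
    (hf : StrictMono f) (hg : StrictMono g) :
    minorOn A (Finset.univ.image f) (Finset.univ.image g) = (A.submatrix f g).det := by
  have h1 : (Finset.univ.image f).card = m := by
    rw [Finset.card_image_of_injective _ hf.injective]; simp
  have h2 : (Finset.univ.image g).card = m := by
    rw [Finset.card_image_of_injective _ hg.injective]; simp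
  rw [minorOn_eq A _ _ h1 h2, ← Finset.orderEmbOfFin_unique h1 (f := f) (by simp) hf,
    ← Finset.orderEmbOfFin_unique h2 (f := g) (by simp) hg]

lemma card_filter_lt {n m : ℕ} (h : m ≤ n) :
    (Finset.univ.filter fun j : Fin n => (j : ℕ) < m) = Finset.univ.image (Fin.castLE h) := by
  ext j
  simp only [Finset.mem_filter, Finset.mem_univ, true_and, Finset.mem_image]
  constructor
  · intro hj; exact ⟨⟨j, hj⟩, rfl⟩
  · rintro ⟨a, rfl⟩; simp

lemma isPosReal_iff (z : ℂ) : IsPosReal z ↔ 0 < z := by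
  rw [IsPosReal, Complex.pos_iff, eq_comm (a := z.im)]

lemma isNonnegReal_iff (z : ℂ) : IsNonnegReal z ↔ 0 ≤ z := by
  rw [IsNonnegReal, Complex.nonneg_iff, eq_comm (a := z.im)]

lemma leftMinor_eq {n m : ℕ} (g : Matrix (Fin n) (Fin n) ℂ) (f : Fin m → Fin n) (hf : StrictMono f)
    (h : m ≤ n) : leftMinor g (Finset.univ.image f) = (g.submatrix f (Fin.castLE h)).det := by
  have h1 : (Finset.univ.image f).card = m := by
    rw [Finset.card_image_of_injective _ hf.injective]; simp
  rw [leftMinor, h1, card_filter_lt h, minorOn_image g f _ hf (Fin.strictMono_castLE h)]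

lemma image_orderEmb {n : ℕ} (I : Finset (Fin n)) {m : ℕ} (h : I.card = m) :
    I = Finset.univ.image (I.orderEmbOfFin h) := by
  simp

lemma unitaryTP_iff {n : ℕ} (g : Matrix (Fin n) (Fin n) ℂ) :
    g ∈ UnitaryTP n ↔ gᴴ * g = 1 ∧ FP g := by
  refine and_congr Iff.rfl ⟨fun H j hj f hf => ?_, fun H I => ?_⟩
  · have := (isPosReal_iff _).1 (H (Finset.univ.image f))
    rw [leftMinor_eq g f hf hj] at this
    exact this
  · have hj : I.card ≤ n := by simpa using Finset.card_le_univ I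
    rw [image_orderEmb I rfl, leftMinor_eq g _ (I.orderEmbOfFin rfl).strictMono hj, isPosReal_iff]
    exact H _ hj _ (I.orderEmbOfFin rfl).strictMono

lemma forall_minor_iff {n k : ℕ} (Q : ℂ → Prop) (P : Matrix (Fin n) (Fin n) ℂ) :
    (∀ I J : Finset (Fin n), I.card = k → J.card = k → Q (minorOn P I J)) ↔
    ∀ f g : Fin k → Fin n, StrictMono f → StrictMono g → Q (P.submatrix f g).det := by
  constructor
  · intro H f g hf hg
    rw [← minorOn_image P f g hf hg]
    apply H
    · rw [Finset.card_image_of_injective _ hf.injective]; simp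
    · rw [Finset.card_image_of_injective _ hg.injective]; simp
  · intro H I J hI hJ
    rw [minorOn_eq P I J hI hJ]
    exact H _ _ (OrderEmbedding.strictMono _) (OrderEmbedding.strictMono _)

lemma mul_diag_mul {n k : ℕ} (hkn : k ≤ n) (g : Matrix (Fin n) (Fin n) ℂ) :
    g * Matrix.diagonal (fun i : Fin n => if (i : ℕ) < k then (1 : ℂ) else 0) * g.conjTranspose =
      g.submatrix id (Fin.castLE hkn) * (g.submatrix id (Fin.castLE hkn))ᴴ := by
  ext a b
  rw [Matrix.mul_apply, Matrix.mul_apply]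
  simp only [Matrix.mul_diagonal, mul_ite, mul_one, mul_zero, ite_mul, zero_mul]
  rw [← Finset.sum_filter, card_filter_lt hkn,
    Finset.sum_image (fun _ _ _ _ h => Fin.castLE_injective hkn h)]
  rfl

/-- Projection onto the column span. -/
noncomputable def colProj {n k : ℕ} (W : Matrix (Fin n) (Fin k) ℂ) : Matrix (Fin n) (Fin n) ℂ :=
  W * (Wᴴ * W)⁻¹ * Wᴴ

lemma colProj_mem {n k : ℕ} (hkn : k ≤ n) {W : Matrix (Fin n) (Fin k) ℂ} (hW : MP W) :
    ∃ g ∈ UnitaryTP n, colProj W =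
      g * Matrix.diagonal (fun i : Fin n => if (i : ℕ) < k then (1 : ℂ) else 0) *
        g.conjTranspose := by
  obtain ⟨G, R, hG, h1, hF⟩ := exists_orth_flag k hkn W hW
  obtain ⟨g, e1, e2, e3⟩ := exists_extend G h1 hF n hkn le_rfl
  refine ⟨g, (unitaryTP_iff g).2 ⟨e1, e2⟩, ?_⟩
  rw [mul_diag_mul hkn, e3, colProj]
  have h2 : Rᴴ * ((Wᴴ * W) * R) = 1 := by
    rw [← h1, hG, Matrix.conjTranspose_mul]; simp only [Matrix.mul_assoc]
  have h3 := mul_eq_one_comm.1 h2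
  have h4 : (Wᴴ * W)⁻¹ = R * Rᴴ := by
    apply Matrix.inv_eq_right_inv
    rw [← h3]; simp only [Matrix.mul_assoc]
  rw [h4, hG, Matrix.conjTranspose_mul]; simp only [Matrix.mul_assoc]

lemma trace_eq_rank {n : ℕ} (P : Matrix (Fin n) (Fin n) ℂ) (hP2 : P * P = P) :
    P.trace = P.rank := by
  have h1 : IsIdempotentElem (Matrix.toLin' P) := by
    rw [IsIdempotentElem, Module.End.mul_eq_comp, ← Matrix.toLin'_mul, hP2]
  have h2 := (LinearMap.IsIdempotentElem.isProj_range _ h1).trace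
  rw [Matrix.trace_toLin'_eq] at h2
  rw [h2]
  rfl

lemma isUnit_gram {n k : ℕ} {W : Matrix (Fin n) (Fin k) ℂ} {f : Fin k → Fin n}
    (hf : (W.submatrix f id).det ≠ 0) : IsUnit (Wᴴ * W).det := by
  have hinj : Function.Injective W.mulVec := by
    intro x y hxy
    have h1 : (W.submatrix f id) *ᵥ x = (W.submatrix f id) *ᵥ y := by
      ext i
      exact congrFun hxy (f i)
    exact Matrix.mulVec_injective_of_isUnit
      ((Matrix.isUnit_iff_isUnit_det _).2 (isUnit_iff_ne_zero.2 hf)) h1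
  exact (Matrix.isUnit_iff_isUnit_det _).1 (Matrix.PosDef.conjTranspose_mul_self W hinj).isUnit

lemma eq_colProj {n k : ℕ} (P : Matrix (Fin n) (Fin n) ℂ) (hP2 : P * P = P)
    (hPH : P.conjTranspose = P) (hPrank : P.rank = k) (W : Matrix (Fin n) (Fin k) ℂ)
    (hPW : P * W = W) (hu : IsUnit (Wᴴ * W).det) : P = colProj W := by
  have hQP : P * colProj W = colProj W := by
    rw [colProj, ← Matrix.mul_assoc, ← Matrix.mul_assoc, hPW]
  have hQH : (colProj W)ᴴ = colProj W := by
    simp only [colProj, Matrix.conjTranspose_mul, Matrix.conjTranspose_nonsing_inv,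
      Matrix.conjTranspose_conjTranspose, Matrix.mul_assoc]
  have hPQ : colProj W * P = colProj W := by
    have := congrArg Matrix.conjTranspose hQP
    rwa [Matrix.conjTranspose_mul, hPH, hQH] at this
  have hQQ : colProj W * colProj W = colProj W := by
    have : colProj W * colProj W = W * ((Wᴴ * W)⁻¹ * (Wᴴ * W)) * (Wᴴ * W)⁻¹ * Wᴴ := by
      simp only [colProj, Matrix.mul_assoc]
    rw [this, Matrix.nonsing_inv_mul _ hu, Matrix.mul_one, colProj]
  have htr : (colProj W).trace = k := by
    rw [colProj, Matrix.trace_mul_comm, ← Matrix.mul_assoc, Matrix.mul_nonsing_inv _ hu]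
    simp
  have h0 : ((P - colProj W)ᴴ * (P - colProj W)).trace = 0 := by
    rw [Matrix.conjTranspose_sub, hPH, hQH, Matrix.sub_mul, Matrix.mul_sub, Matrix.mul_sub, hP2, hQP,
      hPQ, hQQ]
    simp [trace_eq_rank P hP2, hPrank, htr]
  exact sub_eq_zero.1 (Matrix.trace_conjTranspose_mul_self_eq_zero_iff.1 h0)

lemma exists_cols {a b r : ℕ} (A : Matrix (Fin a) (Fin b) ℂ) (h : A.rank = r) :
    ∃ j : Fin r → Fin b, LinearIndependent ℂ (A.submatrix id j).col := by
  rw [Matrix.rank_eq_finrank_span_cols] at h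
  subst h
  obtain ⟨f, hf, -, hl⟩ := Submodule.exists_fun_fin_finrank_span_eq ℂ (Set.range A.col)
  choose j hj using hf
  refine ⟨j, ?_⟩
  have : (A.submatrix id j).col = f := by
    ext i x
    rw [← hj]
    rfl
  rw [this]
  exact hl

lemma sort_rows {a k : ℕ} (A : Matrix (Fin a) (Fin k) ℂ) (i : Fin k → Fin a)
    (h : (A.submatrix i id).det ≠ 0) : ∃ f, StrictMono f ∧ (A.submatrix f id).det ≠ 0 := by
  have hi : Function.Injective i := by
    intro x y hxy
    by_contra hne
    apply h
    apply Matrix.det_zero_of_row_eq hne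
    ext j; simp [hxy]
  refine ⟨i ∘ Tuple.sort i,
    (Tuple.monotone_sort i).strictMono_of_injective (hi.comp (Tuple.sort i).injective), ?_⟩
  have h3 := Matrix.det_permute (Tuple.sort i) (A.submatrix i id)
  have h4 : (A.submatrix i id).submatrix (Tuple.sort i) id =
    A.submatrix (i ∘ Tuple.sort i) id := rfl
  rw [← h4, h3]
  rcases Int.units_eq_one_or (Equiv.Perm.sign (Tuple.sort i)) with h' | h' <;> simpa [h'] using h

lemma exists_minor_ne_zero {n k : ℕ} (P : Matrix (Fin n) (Fin n) ℂ) (h : P.rank = k) :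
    ∃ f g : Fin k → Fin n, StrictMono f ∧ StrictMono g ∧ (P.submatrix f g).det ≠ 0 := by
  obtain ⟨j, hj⟩ := exists_cols P h
  have h1 : ((P.submatrix id j)ᵀ).rank = k := by
    have := LinearIndependent.rank_matrix (M := (P.submatrix id j)ᵀ) hj
    simpa using this
  obtain ⟨i, hi⟩ := exists_cols _ h1
  have h2 := (Matrix.isUnit_iff_isUnit_det _).1 (Matrix.linearIndependent_cols_iff_isUnit.1 hi)
  have h3 : (((P.submatrix id j)).submatrix i id).det ≠ 0 := by
    rw [← Matrix.det_transpose]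
    exact h2.ne_zero
  obtain ⟨f, hf, h4⟩ := sort_rows _ _ h3
  have h5 : (((P.submatrix f id)ᵀ).submatrix j id).det ≠ 0 := by
    rw [← Matrix.det_transpose]
    exact h4
  obtain ⟨g, hg, h6⟩ := sort_rows _ _ h5
  refine ⟨f, g, hf, hg, ?_⟩
  rw [← Matrix.det_transpose]
  exact h6

lemma continuousAt_colProj {n k : ℕ} (W : Matrix (Fin n) (Fin k) ℂ) (hu : IsUnit (Wᴴ * W).det) :
    ContinuousAt colProj W := by
  have h1 : Continuous fun W : Matrix (Fin n) (Fin k) ℂ => Wᴴ * W := by fun_prop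
  have h2 : ContinuousAt (fun W : Matrix (Fin n) (Fin k) ℂ => (Wᴴ * W)⁻¹) W := by
    have : (fun W : Matrix (Fin n) (Fin k) ℂ => (Wᴴ * W)⁻¹) =
        fun W => ((Wᴴ * W).det)⁻¹ • (Wᴴ * W).adjugate := by
      funext W; rw [Matrix.inv_def, Ring.inverse_eq_inv']
    rw [this]
    exact (h1.matrix_det.continuousAt.inv₀ hu.ne_zero).smul h1.matrix_adjugate.continuousAt
  have h3 : Continuous fun p : Matrix (Fin n) (Fin k) ℂ × Matrix (Fin k) (Fin k) ℂ =>
    p.1 * p.2 * p.1ᴴ := by fun_prop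
  exact ContinuousAt.comp (g := fun p : Matrix (Fin n) (Fin k) ℂ × Matrix (Fin k) (Fin k) ℂ =>
    p.1 * p.2 * p.1ᴴ) (f := fun W => (W, (Wᴴ * W)⁻¹)) h3.continuousAt (continuousAt_id.prodMk h2)

lemma strictMono_update {n k : ℕ} {f : Fin k → Fin n} (hf : StrictMono f) (a : Fin k) (j : Fin n)
    (hadj : (j : ℕ) = f a + 1 ∨ (f a : ℕ) = j + 1) (hj : j ∉ Set.range f) :
    StrictMono (Function.update f a j) := by
  intro x y hxy
  have h1 := hf hxy
  rw [Fin.lt_def] at h1 ⊢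
  by_cases hx : x = a
  · subst hx
    have h2 : (f y : ℕ) ≠ j := fun h => hj ⟨y, Fin.ext h⟩
    rw [Function.update_self, Function.update_of_ne hxy.ne']
    omega
  · by_cases hy : y = a
    · subst hy
      have h2 : (f x : ℕ) ≠ j := fun h => hj ⟨x, Fin.ext h⟩
      rw [Function.update_self, Function.update_of_ne hxy.ne]
      omega
    · rw [Function.update_of_ne hx, Function.update_of_ne hy]; exact h1

lemma strictMono_ge {n k : ℕ} {f : Fin k → Fin n} (hf : StrictMono f) (a : Fin k) :
    (a : ℕ) ≤ f a := by
  obtain ⟨a, ha⟩ := a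
  induction a with
  | zero => simp
  | succ a ih =>
    have h1 := ih (by omega)
    have h2 : f ⟨a, by omega⟩ < f ⟨a + 1, ha⟩ := hf (by simp [Fin.lt_def])
    rw [Fin.lt_def] at h2
    simp only at h1 ⊢
    omega

lemma connected_aux {n k : ℕ} (S : (Fin k → Fin n) → Prop) (hkn : k ≤ n)
    (H : ∀ f : Fin k → Fin n, StrictMono f → ∀ (a : Fin k) (j : Fin n), ((j : ℕ) = f a + 1 ∨ (f a : ℕ) = j + 1) →
      StrictMono (Function.update f a j) → (S (Function.update f a j) → S f)) :
    ∀ N (f : Fin k → Fin n), StrictMono f → ∑ a, (f a : ℕ) = N → (S f ↔ S (Fin.castLE hkn)) := by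
  intro N
  induction N using Nat.strong_induction_on with
  | _ N ih =>
  intro f hf hN
  by_cases h : ∀ a, (f a : ℕ) = a
  · have : f = Fin.castLE hkn := by funext a; exact Fin.ext (h a)
    rw [this]
  · push Not at h
    obtain ⟨a, ha, hmin⟩ : ∃ a, (f a : ℕ) ≠ a ∧ ∀ b < a, (f b : ℕ) = b := by
      obtain ⟨a, ha, hm⟩ := WellFounded.has_min (wellFounded_lt (α := Fin k))
        {a | (f a : ℕ) ≠ a} h
      exact ⟨a, ha, fun b hb => by by_contra hc; exact hm b hc hb⟩
    have hge := strictMono_ge hf a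
    have hlt := (f a).2
    set j : Fin n := ⟨f a - 1, by omega⟩ with hj
    have hjr : j ∉ Set.range f := by
      rintro ⟨b, hb⟩
      have hb' : (f b : ℕ) = f a - 1 := by rw [hb]
      have hba : b < a := by
        rw [← hf.lt_iff_lt, Fin.lt_def]; omega
      have := hmin b hba
      rw [Fin.lt_def] at hba
      omega
    have hadj : (f a : ℕ) = j + 1 := by simp only [hj]; omega
    have hsm := strictMono_update hf a j (Or.inr hadj) hjr
    have hsum : ∑ x, (Function.update f a j x : ℕ) < N := by
      rw [← hN]
      apply Finset.sum_lt_sum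
      · intro x _
        by_cases hx : x = a
        · subst hx; rw [Function.update_self]; omega
        · rw [Function.update_of_ne hx]
      · exact ⟨a, Finset.mem_univ _, by rw [Function.update_self]; omega⟩
    rw [← ih _ hsum _ hsm rfl]
    refine ⟨fun hS => ?_, H f hf a j (Or.inr hadj) hsm⟩
    apply H _ hsm a (f a)
    · left; rw [Function.update_self]; exact hadj
    · simpa using hf
    · simpa using hS

lemma exists_move {n k : ℕ} (S : (Fin k → Fin n) → Prop)
    (h1 : ∃ f, StrictMono f ∧ S f) (h2 : ∃ f, StrictMono f ∧ ¬ S f) :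
    ∃ f : Fin k → Fin n, StrictMono f ∧ ¬ S f ∧ ∃ (a : Fin k) (j : Fin n), ((j : ℕ) = f a + 1 ∨ (f a : ℕ) = j + 1) ∧
      StrictMono (Function.update f a j) ∧ S (Function.update f a j) := by
  by_contra hc
  push Not at hc
  obtain ⟨f, hf, hS⟩ := h1
  obtain ⟨f', hf', hS'⟩ := h2
  have hkn : k ≤ n := by simpa using Fintype.card_le_of_injective f hf.injective
  have H := connected_aux S hkn (fun f hf a j hadj hsm hS => by
    by_contra hn
    exact hc f hf hn a j hadj hsm hS)
  exact hS' ((H _ f' hf' rfl).2 ((H _ f hf rfl).1 hS))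

lemma det_rowop_of_mem {n k : ℕ} (V : Matrix (Fin n) (Fin k) ℂ) {f : Fin k → Fin n}
    (hf : Function.Injective f) (a : Fin k) (j : Fin n) (t : ℂ) :
    ((V.updateRow (f a) (V (f a) + t • V j)).submatrix f id).det =
      (V.submatrix f id).det + t * (V.submatrix (Function.update f a j) id).det := by
  have h1 : (V.updateRow (f a) (V (f a) + t • V j)).submatrix f id =
      (V.submatrix f id).updateRow a (V (f a) + t • V j) := by
    ext x y
    by_cases hx : x = a
    · subst hx; simp
    · rw [Matrix.updateRow_ne hx, Matrix.submatrix_apply, Matrix.updateRow_ne (hf.ne hx)]; rfl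
  have h2 : (V.submatrix f id).updateRow a (V (f a)) = V.submatrix f id := by
    ext x y
    by_cases hx : x = a
    · subst hx; simp
    · rw [Matrix.updateRow_ne hx]
  have h3 : (V.submatrix f id).updateRow a (V j) = V.submatrix (Function.update f a j) id := by
    ext x y
    by_cases hx : x = a
    · subst hx; simp
    · simp [Matrix.updateRow_ne hx, Function.update_of_ne hx]
  rw [h1, Matrix.det_updateRow_add, Matrix.det_updateRow_smul, h2, h3]

lemma mem_closure_MP {n k : ℕ} : ∀ N (V : Matrix (Fin n) (Fin k) ℂ),
    (∀ f : Fin k → Fin n, StrictMono f → 0 ≤ (V.submatrix f id).det) →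
    (∃ f : Fin k → Fin n, StrictMono f ∧ (V.submatrix f id).det ≠ 0) →
    {f : Fin k → Fin n | StrictMono f ∧ (V.submatrix f id).det = 0}.ncard = N →
    V ∈ closure {W : Matrix (Fin n) (Fin k) ℂ | MP W} := by
  intro N
  induction N using Nat.strong_induction_on with
  | _ N ih =>
  intro V hV hne hN
  by_cases hz : ∃ f : Fin k → Fin n, StrictMono f ∧ ¬ (V.submatrix f id).det ≠ 0
  swap
  · apply subset_closure
    intro f hf
    push Not at hz
    exact lt_of_le_of_ne (hV f hf) (hz f hf).symm
  obtain ⟨f, hf, hf0, a, j, hadj, hsm, hfj⟩ := exists_move _ hne hz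
  rw [not_not] at hf0
  set T : ℝ → Matrix (Fin n) (Fin k) ℂ := fun t => V.updateRow (f a) (V (f a) + (t : ℂ) • V j)
    with hT
  have hTc : Continuous T := by
    apply Continuous.matrix_updateRow
    · exact continuous_const
    · exact continuous_const.add ((Complex.continuous_ofReal).smul continuous_const)
  have hT0 : T 0 = V := by
    simp [hT]
  have hlim : Filter.Tendsto T (nhdsWithin 0 (Set.Ioi 0)) (nhds V) := by
    have := hTc.tendsto 0
    rw [hT0] at this
    exact this.mono_left nhdsWithin_le_nhds
  rw [← closure_closure]
  refine mem_closure_of_tendsto hlim ?_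
  filter_upwards [self_mem_nhdsWithin] with t ht
  have ht' : (0 : ℂ) < t := by exact_mod_cast (ht : (0 : ℝ) < t)
  have hge : ∀ g : Fin k → Fin n, StrictMono g →
      (V.submatrix g id).det ≤ ((T t).submatrix g id).det := by
    intro g hg
    by_cases hmem : f a ∈ Set.range g
    · obtain ⟨b, hb⟩ := hmem
      have e := det_rowop_of_mem V hg.injective b j t
      rw [hb] at e
      simp only [hT]
      rw [e]
      apply le_add_of_nonneg_right
      apply mul_nonneg ht'.le
      by_cases hjr : j ∈ Set.range g
      · obtain ⟨c, hc⟩ := hjr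
        have hcb : c ≠ b := by
          rintro rfl
          rw [hc] at hb
          rw [hb] at hadj
          omega
        rw [Matrix.det_zero_of_row_eq hcb]
        ext y; simp [Function.update_of_ne hcb, hc]
      · exact hV _ (strictMono_update hg b j (by rw [hb]; exact hadj) hjr)
    · apply le_of_eq
      congr 1
      ext x y
      simp only [hT, Matrix.submatrix_apply]
      rw [Matrix.updateRow_ne]
      exact fun h => hmem ⟨x, h⟩
  have hpos : 0 < ((T t).submatrix f id).det := by
    simp only [hT]
    rw [det_rowop_of_mem V hf.injective a j t, hf0, zero_add]
    exact mul_pos ht' (lt_of_le_of_ne (hV _ hsm) hfj.symm)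
  refine ih _ ?_ (T t) (fun g hg => (hV g hg).trans (hge g hg)) ⟨f, hf, hpos.ne'⟩ rfl
  rw [← hN]
  apply Set.ncard_lt_ncard _ (Set.toFinite _)
  refine ⟨fun g hg => ⟨hg.1, le_antisymm ?_ (hV g hg.1)⟩, fun hsub => ?_⟩
  · rw [← hg.2]; exact hge g hg.1
  · have := hsub (a := f) ⟨hf, hf0⟩
    exact hpos.ne' this.2

lemma minors_pos_of_mem {n k : ℕ} (hkn : k ≤ n) (P : Matrix (Fin n) (Fin n) ℂ)
    (h : ∃ g ∈ UnitaryTP n,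
        P = g * Matrix.diagonal (fun i : Fin n => if (i : ℕ) < k then (1 : ℂ) else 0) *
          g.conjTranspose) (f g : Fin k → Fin n) (hf : StrictMono f) (hg : StrictMono g) :
    0 < (P.submatrix f g).det := by
  obtain ⟨u, hu, rfl⟩ := h
  rw [mul_diag_mul hkn]
  have hF := ((unitaryTP_iff u).1 hu).2 k hkn
  set G := u.submatrix id (Fin.castLE hkn)
  have e : (G * Gᴴ).submatrix f g = G.submatrix f id * (G.submatrix g id)ᴴ := by
    ext i j; simp [Matrix.mul_apply]
  rw [e, Matrix.det_mul, Matrix.det_conjTranspose]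
  exact mul_pos (hF f hf) (star_pos_iff.2 (hF g hg))

lemma colProj_submatrix {n k : ℕ} 
    (P : Matrix (Fin n) (Fin n) ℂ) (hP2 : P * P = P) (hPH : P.conjTranspose = P)
    (hPrank : P.rank = k) (f g : Fin k → Fin n) (h : (P.submatrix f g).det ≠ 0) :
    P = colProj (P.submatrix id g) ∧
      IsUnit ((P.submatrix id g)ᴴ * (P.submatrix id g)).det := by
  have hu : IsUnit ((P.submatrix id g)ᴴ * (P.submatrix id g)).det := isUnit_gram (f := f) h
  refine ⟨eq_colProj P hP2 hPH hPrank _ ?_ hu, hu⟩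
  conv_rhs => rw [← hP2]
  ext i j; simp [Matrix.mul_apply]


theorem projection_core {n k : ℕ} (hk1 : 1 ≤ k) (hkn : k ≤ n)
    (P : Matrix (Fin n) (Fin n) ℂ) (hP2 : P * P = P) (hPH : P.conjTranspose = P)
    (hPrank : P.rank = k) :
    ((∃ g ∈ UnitaryTP n,
        P = g * Matrix.diagonal (fun i : Fin n => if (i : ℕ) < k then (1 : ℂ) else 0) *
          g.conjTranspose) ↔
      ∀ I J : Finset (Fin n), I.card = k → J.card = k → IsPosReal (minorOn P I J)) ∧
    ((P ∈ closure {Q : Matrix (Fin n) (Fin n) ℂ | ∃ g ∈ UnitaryTP n,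
        Q = g * Matrix.diagonal (fun i : Fin n => if (i : ℕ) < k then (1 : ℂ) else 0) *
          g.conjTranspose}) ↔
      ∀ I J : Finset (Fin n), I.card = k → J.card = k → IsNonnegReal (minorOn P I J)) := by
  simp only [isPosReal_iff, isNonnegReal_iff]
  rw [forall_minor_iff (fun z => (0 < z)) P,
    forall_minor_iff (fun z => (0 ≤ z)) P]
  refine ⟨⟨fun h f g hf hg => minors_pos_of_mem hkn P h f g hf hg, fun H => ?_⟩, ⟨fun h => ?_, fun H => ?_⟩⟩
  · have hc : StrictMono (Fin.castLE hkn) := Fin.strictMono_castLE hkn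
    have h1 := (colProj_submatrix P hP2 hPH hPrank _ _ (H _ _ hc hc).ne').1
    rw [h1]
    exact colProj_mem hkn fun f hf => H f _ hf hc
  · intro f g hf hg
    have hcl : IsClosed {Q : Matrix (Fin n) (Fin n) ℂ |
        0 ≤ (Q.submatrix f g).det} := by
      have hcont : Continuous fun Q : Matrix (Fin n) (Fin n) ℂ => (Q.submatrix f g).det :=
        (continuous_id.matrix_submatrix f g).matrix_det
      simp only [Complex.nonneg_iff, Set.ofPred_and]
      exact (isClosed_le continuous_const (Complex.continuous_re.comp hcont)).inter
        (isClosed_eq continuous_const (Complex.continuous_im.comp hcont))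
    exact closure_minimal (fun Q hQ => (minors_pos_of_mem hkn Q hQ f g hf hg).le) hcl h
  · obtain ⟨f, g, hf, hg, hne⟩ := exists_minor_ne_zero P hPrank
    obtain ⟨h1, h2⟩ := colProj_submatrix P hP2 hPH hPrank f g hne
    have h3 := mem_closure_MP _ (P.submatrix id g) (fun f hf => H f g hf hg) ⟨f, hf, hne⟩ rfl
    rw [h1]
    refine ((continuousAt_colProj _ h2).continuousWithinAt).mem_closure h3 ?_
    intro W hW
    exact colProj_mem hkn hW

end TPProj

/-- Let `P` be an orthogonal projection of rank `k` (`P² = P = P*`).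
(a) `P = g·diag(1,…,1,0,…,0)·g*` for some `g ∈ U_n^{>0}` iff every `k×k` minor of `P`
is a positive real; (b) `P` lies in the closure of the set of such projections iff every
`k×k` minor of `P` is a nonnegative real. -/
theorem projection_totally_positive_iff {n k : ℕ} (hk1 : 1 ≤ k) (hkn : k ≤ n)
    (P : Matrix (Fin n) (Fin n) ℂ) (hP2 : P * P = P) (hPH : P.conjTranspose = P)
    (hPrank : P.rank = k) :
    ((∃ g ∈ UnitaryTP n,
        P = g * Matrix.diagonal (fun i : Fin n => if (i : ℕ) < k then (1 : ℂ) else 0) *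
          g.conjTranspose) ↔
      ∀ I J : Finset (Fin n), I.card = k → J.card = k → IsPosReal (minorOn P I J)) ∧
    ((P ∈ closure {Q : Matrix (Fin n) (Fin n) ℂ | ∃ g ∈ UnitaryTP n,
        Q = g * Matrix.diagonal (fun i : Fin n => if (i : ℕ) < k then (1 : ℂ) else 0) *
          g.conjTranspose}) ↔
      ∀ I J : Finset (Fin n), I.card = k → J.card = k → IsNonnegReal (minorOn P I J)) := by
  exact projection_core hk1 hkn P hP2 hPH hPrank
end

section
/- Let λ ∈ ℝⁿ be weakly decreasing (λ₁ ≥ ⋯ ≥ λₙ) and nonconstant. (a) If L = g·diag(λ₁,…,λₙ)·g* with g ∈ U_n^{>0} (i.e., L ∈ O_λ^{>0}), then for every 1 ≤ i ≤ n−1 the entry L_{i,i+1} is a positive real number and L_{i+1,i} = L_{i,i+1}. (b) If L ∈ O_λ^{≥0}, then for every 1 ≤ i ≤ n−1 the entry L_{i,i+1} is a nonnegative real number and L_{i+1,i} = L_{i,i+1}. -/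
open Matrix Finset

/-- The totally positive part `O_λ^{>0}` of the adjoint orbit: Hermitian matrices
`g · diag(λ) · g*` with `g ∈ U_n^{>0}`. -/
def OrbitTP {n : ℕ} (lam : Fin n → ℝ) : Set (Matrix (Fin n) (Fin n) ℂ) :=
  {L | ∃ g ∈ UnitaryTP n,
    L = g * Matrix.diagonal (fun i => (lam i : ℂ)) * g.conjTranspose}

/-- The totally nonnegative part `O_λ^{≥0}`: the closure of `O_λ^{>0}` in the space of
`n×n` complex matrices. -/
noncomputable def OrbitTNN {n : ℕ} (lam : Fin n → ℝ) : Set (Matrix (Fin n) (Fin n) ℂ) :=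
  closure (OrbitTP lam)

/-- Unsymmetrized Cauchy-Binet. -/
theorem cb_aux {k n : ℕ} (A : Matrix (Fin k) (Fin n) ℂ) (B : Matrix (Fin n) (Fin k) ℂ) :
    (A * B).det = ∑ f : Fin k → Fin n, (∏ a, A a (f a)) * (B.submatrix f id).det := by
  have h : A * B = fun a => ∑ r, A a r • B r := by
    ext a b
    simp [Matrix.mul_apply, Finset.sum_apply]
  have h2 := (Matrix.detRowAlternating (n := Fin k) (R := ℂ)).toMultilinearMap.map_sum
    (fun a (r : Fin n) => A a r • B r)
  have h3 : (A * B).det = ∑ f : Fin k → Fin n,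
      (Matrix.detRowAlternating (n := Fin k) (R := ℂ)).toMultilinearMap
        (fun a => A a (f a) • B (f a)) := by
    rw [h]; exact h2
  rw [h3]
  refine Finset.sum_congr rfl fun f _ => ?_
  rw [MultilinearMap.map_smul_univ]
  rfl

/-- Symmetrized Cauchy-Binet. -/
theorem cb_sym {k n : ℕ} (A : Matrix (Fin k) (Fin n) ℂ) (B : Matrix (Fin n) (Fin k) ℂ) :
    (k.factorial : ℂ) * (A * B).det =
      ∑ f : Fin k → Fin n, (A.submatrix id f).det * (B.submatrix f id).det := by
  have h1 : ∀ σ : Equiv.Perm (Fin k), (A * B).det = ∑ f : Fin k → Fin n,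
      (∏ a, A a (f (σ a))) * (((Equiv.Perm.sign σ : ℤ) : ℂ) * (B.submatrix f id).det) := by
    intro σ
    rw [cb_aux]
    refine Fintype.sum_equiv (σ.arrowCongr (Equiv.refl _)) _ _ fun f => ?_
    have h2 := Matrix.det_permute σ (B.submatrix (f ∘ σ.symm) id)
    have h4 : (σ.arrowCongr (Equiv.refl (Fin n))) f = f ∘ σ.symm := rfl
    rw [h4]
    refine Eq.trans ?_ (congrArg _ h2)
    simp [Function.comp_def]
  have h3 : (k.factorial : ℂ) * (A * B).det = ∑ _σ : Equiv.Perm (Fin k), (A * B).det := by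
    simp [Fintype.card_perm]
  rw [h3, Finset.sum_congr rfl fun σ _ => h1 σ, Finset.sum_comm]
  refine Finset.sum_congr rfl fun f _ => ?_
  rw [← Matrix.det_transpose (A.submatrix id f), Matrix.det_apply' (A.submatrix id f)ᵀ,
    Finset.sum_mul]
  refine Finset.sum_congr rfl fun σ _ => ?_
  simp only [Matrix.transpose_apply, Matrix.submatrix_apply, id]
  ring

open ComplexOrder in
theorem pos_of_strictMono {k n : ℕ} (hk : k ≤ n) (g : Matrix (Fin n) (Fin n) ℂ)
    (hg : ∀ I : Finset (Fin n), IsPosReal (leftMinor g I))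
    (f : Fin k → Fin n) (hf : StrictMono f) :
    0 < (g.submatrix f (Fin.castLE hk)).det := by
  have h := hg (Finset.univ.image f)
  have hc : (Finset.univ.image f).card = k := by
    rw [Finset.card_image_of_injective _ hf.injective]; simp
  generalize hI : Finset.univ.image f = I at h hc
  subst hc
  have hJ : (Finset.univ.filter fun j : Fin n => (j : ℕ) < I.card).card = I.card := by
    rw [Fin.card_filter_val_lt]; omega
  have e1 : f = I.orderEmbOfFin rfl :=
    Finset.orderEmbOfFin_unique rfl (fun x => by rw [← hI]; simp) hf
  have e2 : Fin.castLE hk =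
      (Finset.univ.filter fun j : Fin n => (j : ℕ) < I.card).orderEmbOfFin hJ :=
    Finset.orderEmbOfFin_unique hJ (fun x => by simp) (Fin.strictMono_castLE hk)
  have e3 : leftMinor g I = (g.submatrix f (Fin.castLE hk)).det := by
    unfold leftMinor minorOn
    rw [dif_pos hJ, e1, e2]
    rfl
  rw [e3] at h
  rw [Complex.lt_def]
  exact ⟨h.1, h.2.symm⟩

open ComplexOrder in
/-- Exchanging adjacent indices does not change the sign of a minor. -/
theorem term_pos {k n : ℕ} (hk : k ≤ n) (g : Matrix (Fin n) (Fin n) ℂ)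
    (hg : ∀ I : Finset (Fin n), IsPosReal (leftMinor g I))
    (i j : Fin n) (hij : (j : ℕ) = (i : ℕ) + 1)
    (f : Fin k → Fin n) (hf : Function.Injective f) (a : Fin k) (ha : f a = j)
    (hi : ∀ b, f b ≠ i) :
    0 < star (g.submatrix f (Fin.castLE hk)).det *
      (g.submatrix (Function.update f a i) (Fin.castLE hk)).det := by
  set σ := Tuple.sort f with hσ
  have hm : StrictMono (f ∘ σ) :=
    (Tuple.monotone_sort f).strictMono_of_injective (hf.comp σ.injective)
  have hm2 : StrictMono (Function.update f a i ∘ σ) := by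
    intro x y hxy
    have h0 := hm hxy
    have hx := hi (σ x)
    have hy := hi (σ y)
    simp only [Function.comp, Function.update_apply] at h0 ⊢
    split_ifs with h1 h2 h2
    · rw [h1, h2] at h0; exact absurd h0 (lt_irrefl _)
    · rw [h1, ha] at h0; rw [Fin.lt_def] at h0 ⊢; omega
    · rw [h2, ha] at h0; rw [Fin.lt_def] at h0 ⊢
      have : (f (σ x) : ℕ) ≠ i := fun h => hx (Fin.ext h)
      omega
    · exact h0
  have p1 := pos_of_strictMono hk g hg _ hm
  have p2 := pos_of_strictMono hk g hg _ hm2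
  have q : ∀ u : Fin k → Fin n, (g.submatrix (u ∘ σ) (Fin.castLE hk)).det =
      ((Equiv.Perm.sign σ : ℤ) : ℂ) * (g.submatrix u (Fin.castLE hk)).det := fun u =>
    Matrix.det_permute σ (g.submatrix u (Fin.castLE hk))
  have p3 := mul_pos (star_pos_iff.mpr p1) p2
  rw [q, q] at p3
  rcases Int.units_eq_one_or (Equiv.Perm.sign σ) with hs | hs <;> rw [hs] at p3 <;>
    simpa using p3

open ComplexOrder in
theorem proj_pos {k n : ℕ} (hk : k ≤ n) (hk0 : 0 < k) (hkn : k < n)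
    (g : Matrix (Fin n) (Fin n) ℂ) (hu : g.conjTranspose * g = 1)
    (hg : ∀ I : Finset (Fin n), IsPosReal (leftMinor g I))
    (i j : Fin n) (hij : (j : ℕ) = (i : ℕ) + 1) :
    0 < ∑ b : Fin k, g i (Fin.castLE hk b) * star (g j (Fin.castLE hk b)) := by
  have hne : i ≠ j := by intro h; rw [h] at hij; omega
  set V : Matrix (Fin n) (Fin k) ℂ := g.submatrix id (Fin.castLE hk) with hV
  obtain ⟨W, hW⟩ : ∃ W : Matrix (Fin n) (Fin k) ℂ,
      ∀ r b, W r b = V r b + if r = j then V i b else 0 :=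
    ⟨Matrix.of fun r b => V r b + if r = j then V i b else 0, fun _ _ => rfl⟩
  have hVV : Vᴴ * V = 1 := by
    ext a b
    have := congrFun (congrFun hu (Fin.castLE hk a)) (Fin.castLE hk b)
    rw [Matrix.mul_apply, Matrix.one_apply] at this ⊢
    simpa [hV] using this
  have hVW : Vᴴ * W = 1 + replicateCol Unit (fun b => star (V j b)) *
      replicateRow Unit (V i) := by
    rw [← hVV]
    ext a b
    simp [Matrix.mul_apply, hW, mul_add, Finset.sum_add_distrib]
  have d1 : (Vᴴ * W).det = 1 + ∑ b : Fin k, g i (Fin.castLE hk b) *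
      star (g j (Fin.castLE hk b)) := by
    rw [hVW, det_one_add_replicateCol_mul_replicateRow]
    rfl
  have c1 := cb_sym Vᴴ W
  have c2 := cb_sym Vᴴ V
  rw [d1] at c1
  rw [hVV, Matrix.det_one] at c2
  have key : (k.factorial : ℂ) * (∑ b : Fin k, g i (Fin.castLE hk b) *
      star (g j (Fin.castLE hk b))) = ∑ f : Fin k → Fin n,
        star (V.submatrix f id).det * ((W.submatrix f id).det - (V.submatrix f id).det) := by
    have hs : ∀ f : Fin k → Fin n, (Vᴴ.submatrix id f).det = star (V.submatrix f id).det := by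
      intro f
      rw [← Matrix.det_conjTranspose]; rfl
    simp only [hs] at c1 c2
    simp only [mul_sub, Finset.sum_sub_distrib]
    rw [← c1, ← c2]; ring
  -- each term
  have hterm : ∀ f : Fin k → Fin n, Function.Injective f → ∀ a, f a = j →
      (W.submatrix f id).det - (V.submatrix f id).det =
        (V.submatrix (Function.update f a i) id).det := by
    intro f hf a ha
    have e1 : W.submatrix f id = (V.submatrix f id).updateRow a (V j + V i) := by
      ext x b
      by_cases hx : x = a
      · subst hx; simp [hW, ha]
      · have : f x ≠ j := fun h => hx (hf (h.trans ha.symm))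
        simp [hW, this, Matrix.updateRow_ne hx]
    have e2 : (V.submatrix f id).updateRow a (V j) = V.submatrix f id := by
      ext x b
      by_cases hx : x = a
      · subst hx; simp [ha]
      · simp [Matrix.updateRow_ne hx]
    have e3 : (V.submatrix f id).updateRow a (V i) =
        V.submatrix (Function.update f a i) id := by
      ext x b
      by_cases hx : x = a
      · subst hx; simp
      · simp [Matrix.updateRow_ne hx, hx]
    rw [e1, Matrix.det_updateRow_add, e2, e3]; ring
  have hzero : ∀ f : Fin k → Fin n, ¬ Function.Injective f → (V.submatrix f id).det = 0 := by
    intro f hf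
    rw [Function.Injective] at hf
    push Not at hf
    obtain ⟨x, y, hxy, hn⟩ := hf
    refine Matrix.det_zero_of_row_eq hn ?_
    ext b; simp [hxy]
  have hpos : ∀ f : Fin k → Fin n, Function.Injective f → ∀ a, f a = j → (∀ b, f b ≠ i) →
      0 < star (V.submatrix f id).det *
        ((W.submatrix f id).det - (V.submatrix f id).det) := by
    intro f hf a ha hi
    rw [hterm f hf a ha]
    exact term_pos hk g hg i j hij f hf a ha hi
  have hsum : 0 < ∑ f : Fin k → Fin n,
        star (V.submatrix f id).det * ((W.submatrix f id).det - (V.submatrix f id).det) := by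
    refine Finset.sum_pos' (fun f _ => ?_) ?_
    · by_cases hf : Function.Injective f
      · by_cases hj : ∃ a, f a = j
        · obtain ⟨a, ha⟩ := hj
          by_cases hi : ∀ b, f b ≠ i
          · exact (hpos f hf a ha hi).le
          · push Not at hi
            obtain ⟨b, hb⟩ := hi
            rw [hterm f hf a ha, hzero (Function.update f a i), mul_zero]
            intro hinj
            have hba : b ≠ a := by rintro rfl; exact hne (hb.symm.trans ha)
            refine hba (hinj ?_)
            simp [hba, hb]
        · push Not at hj
          have : W.submatrix f id = V.submatrix f id := by
            ext x b; simp [hW, hj x]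
          rw [this]; simp
      · rw [hzero f hf]; simp
    · obtain ⟨I, h1, h2, h3⟩ := Finset.exists_subsuperset_card_eq
        (s := {j}) (t := Finset.univ.erase i) (n := k)
        (by simpa using hne.symm) (by simp; omega)
        (by rw [Finset.card_erase_of_mem (Finset.mem_univ _)]; simp; omega)
      have hj : j ∈ Set.range (I.orderEmbOfFin h3) := by
        rw [Finset.range_orderEmbOfFin]; exact_mod_cast h1 (Finset.mem_singleton_self j)
      obtain ⟨a, ha⟩ := hj
      refine ⟨I.orderEmbOfFin h3, Finset.mem_univ _, hpos _
        (I.orderEmbOfFin h3).injective a ha fun b hb => ?_⟩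
      have := h2 (Finset.orderEmbOfFin_mem I h3 b)
      rw [hb] at this
      simp at this
  rw [← key] at hsum
  have hfac : (0 : ℂ) < (k.factorial : ℂ) := by exact_mod_cast k.factorial_pos
  exact (mul_pos_iff_of_pos_left hfac).mp hsum

open ComplexOrder in
theorem entry_pos {n : ℕ} (lam : Fin n → ℝ)
    (hanti : Antitone lam) (hnc : ∃ a b : Fin n, lam a ≠ lam b)
    (g : Matrix (Fin n) (Fin n) ℂ) (hu : g.conjTranspose * g = 1)
    (hg : ∀ I : Finset (Fin n), IsPosReal (leftMinor g I))
    (i j : Fin n) (hij : (j : ℕ) = (i : ℕ) + 1) :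
    0 < (g * Matrix.diagonal (fun i => (lam i : ℂ)) * g.conjTranspose) i j := by
  have hn : 0 < n := i.pos
  let nu : ℕ → ℝ := fun m => lam ⟨min m (n - 1), by omega⟩
  let q : ℕ → ℂ := fun m => if h : m < n then g i ⟨m, h⟩ * star (g j ⟨m, h⟩) else 0
  have hnu : ∀ m (h : m < n), nu m = lam ⟨m, h⟩ := by
    intro m h
    simp only [nu]; congr 2; omega
  have hE : (g * Matrix.diagonal (fun i => (lam i : ℂ)) * g.conjTranspose) i j =
      ∑ m ∈ Finset.range n, (nu m : ℂ) • q m := by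
    rw [Matrix.mul_apply, Finset.sum_range]
    refine Finset.sum_congr rfl fun m _ => ?_
    rw [hnu m m.2]
    simp [q, Matrix.mul_diagonal]
    ring
  have hQ : ∀ k (hk : k ≤ n), ∑ m ∈ Finset.range k, q m =
      ∑ b : Fin k, g i (Fin.castLE hk b) * star (g j (Fin.castLE hk b)) := by
    intro k hk
    rw [Finset.sum_range]
    refine Finset.sum_congr rfl fun m _ => ?_
    have : (m : ℕ) < n := by omega
    simp only [q, dif_pos this]
    rfl
  have hQn : ∑ m ∈ Finset.range n, q m = 0 := by
    rw [hQ n le_rfl]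
    have h1 : g * g.conjTranspose = 1 := mul_eq_one_comm.mp hu
    have h2 := congrFun (congrFun h1 i) j
    have hne : i ≠ j := by intro h; rw [h] at hij; omega
    rw [Matrix.mul_apply, Matrix.one_apply_ne hne] at h2
    exact h2
  have hanu : Antitone nu := by
    intro a b hab
    apply hanti
    rw [Fin.mk_le_mk]; omega
  rw [hE, Finset.sum_range_by_parts, hQn, smul_zero, zero_sub, ← Finset.sum_neg_distrib]
  have hpq : ∀ m ∈ Finset.range (n - 1), 0 < ∑ l ∈ Finset.range (m + 1), q l := by
    intro m hm
    rw [Finset.mem_range] at hm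
    rw [hQ (m + 1) (by omega)]
    exact proj_pos (by omega) (by omega) (by omega) g hu hg i j hij
  have hre : ∀ m, -(((nu (m + 1) : ℂ) - (nu m : ℂ)) • ∑ l ∈ Finset.range (m + 1), q l) =
      ((nu m - nu (m + 1) : ℝ) : ℂ) * ∑ l ∈ Finset.range (m + 1), q l := by
    intro m; push_cast; rw [smul_eq_mul]; ring
  simp only [hre]
  refine Finset.sum_pos' (fun m hm => ?_) ?_
  · refine mul_nonneg ?_ (hpq m hm).le
    have := hanu (Nat.le_succ m)
    exact_mod_cast sub_nonneg.mpr this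
  · by_contra! hcon
    have hst : ∀ m, nu m = nu (m + 1) := by
      intro m
      by_cases hm : m < n - 1
      · by_contra hne
        have h1 : nu (m + 1) < nu m := lt_of_le_of_ne (hanu (Nat.le_succ m)) (Ne.symm hne)
        have h2 : (0 : ℂ) < ((nu m - nu (m + 1) : ℝ) : ℂ) := by
          exact_mod_cast sub_pos.mpr h1
        exact hcon m (Finset.mem_range.mpr hm) (mul_pos h2 (hpq m (Finset.mem_range.mpr hm)))
      · simp only [nu]; congr 2; omega
    have hc : ∀ m, nu m = nu 0 := by
      intro m
      induction m with
      | zero => rfl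
      | succ m ih => rw [← hst m, ih]
    obtain ⟨a, b, hab⟩ := hnc
    apply hab
    have ha := hnu a a.2
    have hb := hnu b b.2
    rw [hc] at ha hb
    exact ha.symm.trans hb

/-- Let `λ` be weakly decreasing and nonconstant. (a) For
`L ∈ O_λ^{>0}`, each superdiagonal entry `L_{i,i+1}` is a positive real and
`L_{i+1,i} = L_{i,i+1}`; (b) for `L ∈ O_λ^{≥0}`, each superdiagonal entry is a
nonnegative real and `L_{i+1,i} = L_{i,i+1}`. -/
theorem superdiagonal_positivity {n : ℕ} (lam : Fin n → ℝ)
    (hanti : Antitone lam) (hnc : ∃ a b : Fin n, lam a ≠ lam b) :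
    (∀ L ∈ OrbitTP lam, ∀ i j : Fin n, (j : ℕ) = (i : ℕ) + 1 →
      IsPosReal (L i j) ∧ L j i = L i j) ∧
    (∀ L ∈ OrbitTNN lam, ∀ i j : Fin n, (j : ℕ) = (i : ℕ) + 1 →
      IsNonnegReal (L i j) ∧ L j i = L i j) := by
  have ha : ∀ L ∈ OrbitTP lam, ∀ i j : Fin n, (j : ℕ) = (i : ℕ) + 1 →
      IsPosReal (L i j) ∧ L j i = L i j := by
    rintro L ⟨g, ⟨hu, hg⟩, rfl⟩ i j hij
    have h := entry_pos lam hanti hnc g hu hg i j hij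
    rw [Complex.lt_def] at h
    have hp : IsPosReal ((g * Matrix.diagonal (fun i => (lam i : ℂ)) * g.conjTranspose) i j) :=
      ⟨h.1, h.2.symm⟩
    refine ⟨hp, ?_⟩
    have hH : (g * Matrix.diagonal (fun i => (lam i : ℂ)) * g.conjTranspose)ᴴ =
        g * Matrix.diagonal (fun i => (lam i : ℂ)) * g.conjTranspose := by
      rw [Matrix.conjTranspose_mul, Matrix.conjTranspose_mul, Matrix.conjTranspose_conjTranspose,
        Matrix.diagonal_conjTranspose, Matrix.mul_assoc]
      congr 3
      ext i
      simp
    have h2 := congrFun (congrFun hH j) i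
    rw [Matrix.conjTranspose_apply] at h2
    rw [← h2]
    exact Complex.conj_eq_iff_im.mpr hp.2
  refine ⟨ha, fun L hL i j hij => ?_⟩
  have hcl : IsClosed {M : Matrix (Fin n) (Fin n) ℂ |
      (0 ≤ (M i j).re ∧ (M i j).im = 0) ∧ M j i = M i j} := by
    have c1 : Continuous fun M : Matrix (Fin n) (Fin n) ℂ => M i j := continuous_id.matrix_elem i j
    have c2 : Continuous fun M : Matrix (Fin n) (Fin n) ℂ => M j i := continuous_id.matrix_elem j i
    refine IsClosed.and (IsClosed.and ?_ ?_) ?_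
    · exact isClosed_le continuous_const (Complex.continuous_re.comp c1)
    · exact isClosed_eq (Complex.continuous_im.comp c1) continuous_const
    · exact isClosed_eq c2 c1
  have hsub : OrbitTP lam ⊆ {M : Matrix (Fin n) (Fin n) ℂ |
      (0 ≤ (M i j).re ∧ (M i j).im = 0) ∧ M j i = M i j} := fun M hM =>
    ⟨⟨(ha M hM i j hij).1.1.le, (ha M hM i j hij).1.2⟩, (ha M hM i j hij).2⟩
  exact closure_minimal hsub hcl hL
end
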